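/- Suppose the dynamical system (X,T,μ) satisfies the polynomial concentration inequality with moment q ≥ 2 and constant C_q > 0. Then there exists a constant D_q > 0 such that for every ε > 0, every n ≥ 1, every separately Lipschitz K : (ℝ^d)^n → ℝ, and every t > 0, μ_n ⊗ P^n(|K(y_0,…,y_{n−1}) − E_{μ_n ⊗ P^n}[K(y_0,…,y_{n−1})]| > t) ≤ (D_q / t^q) (1 + ε)^q (Σ_{j=0}^{n−1} Lip_j(K)²)^{q/2}. -/

import Mathlib

open MeasureTheory Real

noncomputable section

/-- `K` is separately Lipschitz in each of its `n` variables, with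
`L j` a Lipschitz constant for the `j`-th variable. -/
def SepLip {E : Type*} [PseudoMetricSpace E] {n : ℕ}
    (K : (Fin n → E) → ℝ) (L : Fin n → ℝ) : Prop :=
  ∀ (x : Fin n → E) (j : Fin n) (y : E),
    |K x - K (Function.update x j y)| ≤ L j * dist (x j) y

section Helpers

set_option linter.unusedSectionVars false

variable {E : Type*} [NormedAddCommGroup E] [MeasurableSpace E] [BorelSpace E]
  [SecondCountableTopology E]

theorem SepLip.abs_sub_le {E : Type*} [PseudoMetricSpace E] {n : ℕ}
    {K : (Fin n → E) → ℝ} {L : Fin n → ℝ} (h : SepLip K L) (x y : Fin n → E) :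
    |K x - K y| ≤ ∑ j, |L j| * dist (x j) (y j) := by
  have key : ∀ s : Finset (Fin n),
      |K x - K (s.piecewise y x)| ≤ ∑ j ∈ s, |L j| * dist (x j) (y j) := by
    intro s
    induction s using Finset.induction_on with
    | empty => simp
    | insert j s hj ih =>
      rw [Finset.piecewise_insert, Finset.sum_insert hj]
      have h1 := h (s.piecewise y x) j (y j)
      rw [Finset.piecewise_eq_of_notMem _ _ _ hj] at h1
      have h2 : L j * dist (x j) (y j) ≤ |L j| * dist (x j) (y j) :=
        mul_le_mul_of_nonneg_right (le_abs_self _) dist_nonneg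
      have h3 := _root_.abs_sub_le (K x) (K (s.piecewise y x))
        (K (Function.update (s.piecewise y x) j (y j)))
      linarith
  simpa using key Finset.univ

theorem SepLip.continuous {E : Type*} [PseudoMetricSpace E] {n : ℕ}
    {K : (Fin n → E) → ℝ} {L : Fin n → ℝ} (h : SepLip K L) : Continuous K := by
  rw [continuous_iff_continuousAt]
  intro x
  rw [ContinuousAt, tendsto_iff_dist_tendsto_zero]
  have hc : Continuous fun y : Fin n → E => ∑ j, |L j| * dist (y j) (x j) := by fun_prop
  have h0 := hc.tendsto x
  simp only [dist_self, mul_zero, Finset.sum_const_zero] at h0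
  exact squeeze_zero (fun _ => dist_nonneg) (fun y => by
    rw [Real.dist_eq]; exact h.abs_sub_le y x) h0

theorem ae_pi_ball (P : Measure E) [IsProbabilityMeasure P] (hP : ∀ᵐ ξ ∂P, ‖ξ‖ ≤ 1) (n : ℕ) :
    ∀ᵐ v ∂(Measure.pi fun _ : Fin n => P), ∀ j, ‖v j‖ ≤ 1 := by
  rw [ae_all_iff]
  intro j
  exact (Measure.quasiMeasurePreserving_eval (fun _ : Fin n => P) j).ae hP

theorem SepLip.ae_bound {n : ℕ} {f : (Fin n → E) → ℝ} {L : Fin n → ℝ} (h : SepLip f L)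
    (P : Measure E) [IsProbabilityMeasure P] (hP : ∀ᵐ ξ ∂P, ‖ξ‖ ≤ 1) :
    ∀ᵐ v ∂(Measure.pi fun _ : Fin n => P), |f v| ≤ |f 0| + ∑ j, |L j| := by
  filter_upwards [ae_pi_ball P hP n] with v hv
  have h1 := h.abs_sub_le v 0
  have h2 : ∑ j, |L j| * dist (v j) ((0 : Fin n → E) j) ≤ ∑ j, |L j| := by
    refine Finset.sum_le_sum fun j _ => ?_
    have := hv j
    simp only [Pi.zero_apply, dist_zero_right]
    exact mul_le_of_le_one_right (abs_nonneg _) this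
  have h3 := abs_sub_abs_le_abs_sub (f v) (f 0)
  linarith

theorem SepLip.integrable {n : ℕ} {f : (Fin n → E) → ℝ} {L : Fin n → ℝ} (h : SepLip f L)
    (P : Measure E) [IsProbabilityMeasure P] (hP : ∀ᵐ ξ ∂P, ‖ξ‖ ≤ 1) :
    Integrable f (Measure.pi fun _ : Fin n => P) :=
  Integrable.of_bound h.continuous.measurable.aestronglyMeasurable _ (h.ae_bound P hP)

theorem SepLip.integrable_exp {n : ℕ} {f : (Fin n → E) → ℝ} {L : Fin n → ℝ} (h : SepLip f L)
    (P : Measure E) [IsProbabilityMeasure P] (hP : ∀ᵐ ξ ∂P, ‖ξ‖ ≤ 1) (t c : ℝ) :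
    Integrable (fun v => Real.exp (t * (f v - c))) (Measure.pi fun _ : Fin n => P) := by
  have hm : Measurable f := h.continuous.measurable
  refine Integrable.of_bound (C := Real.exp (|t| * ((|f 0| + ∑ j, |L j|) + |c|)))
    (by fun_prop) ?_
  filter_upwards [h.ae_bound P hP] with v hv
  rw [Real.norm_eq_abs, abs_of_pos (Real.exp_pos _)]
  refine Real.exp_le_exp.2 ((le_abs_self _).trans ?_)
  rw [abs_mul]
  refine mul_le_mul_of_nonneg_left ?_ (abs_nonneg _)
  have := abs_sub (f v) c
  linarith

theorem SepLip.cons_right {E : Type*} [PseudoMetricSpace E] {n : ℕ} {f : (Fin (n+1) → E) → ℝ}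
    {L : Fin (n+1) → ℝ} (h : SepLip f L) (a : E) :
    SepLip (fun v : Fin n → E => f (Fin.cons a v)) (fun j => L j.succ) := by
  intro x j y
  have := h (Fin.cons a x) j.succ y
  simpa [Fin.cons_update] using this

theorem SepLip.mcdiarmid (P : Measure E) [IsProbabilityMeasure P] (hP : ∀ᵐ ξ ∂P, ‖ξ‖ ≤ 1) :
    ∀ {n : ℕ} {f : (Fin n → E) → ℝ} {L : Fin n → ℝ}, SepLip f L → ∀ t : ℝ,
    ∫ v, Real.exp (t * (f v - ∫ w, f w ∂(Measure.pi fun _ : Fin n => P)))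
      ∂(Measure.pi fun _ : Fin n => P) ≤ Real.exp ((∑ j, L j ^ 2) * t ^ 2 / 2) := by
  intro n
  induction n with
  | zero =>
    intro f L h t
    have : ∀ v, f v = f 0 := fun v => congrArg f (Subsingleton.elim _ _)
    simp [this]
  | succ n ih =>
    intro f L h t
    set ν := Measure.pi fun _ : Fin n => P with hν
    have hmp := (measurePreserving_piFinSuccAbove (fun _ : Fin (n+1) => P) 0).symm
    have hsy : ∀ p : E × (Fin n → E),
        (MeasurableEquiv.piFinSuccAbove (fun _ : Fin (n+1) => E) 0).symm p
          = Fin.cons p.1 p.2 := fun p => Fin.insertNth_zero' p.1 p.2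
    have tr : ∀ F : (Fin (n+1) → E) → ℝ,
        ∫ v, F v ∂(Measure.pi fun _ : Fin (n+1) => P)
          = ∫ p : E × (Fin n → E), F (Fin.cons p.1 p.2) ∂(P.prod ν) := by
      intro F
      rw [← hmp.integral_comp (MeasurableEquiv.measurableEmbedding _)]
      simp only [hsy]
      rfl
    have tri : ∀ F : (Fin (n+1) → E) → ℝ,
        Integrable F (Measure.pi fun _ : Fin (n+1) => P) →
          Integrable (fun p : E × (Fin n → E) => F (Fin.cons p.1 p.2)) (P.prod ν) := by
      intro F hF
      have := (hmp.integrable_comp_emb (MeasurableEquiv.measurableEmbedding _)).2 hF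
      simp only [Function.comp_def, hsy] at this
      exact this
    have hfi := tri f (h.integrable P hP)
    set g : E → ℝ := fun a => ∫ v, f (Fin.cons a v) ∂ν with hg
    set m := ∫ w, f w ∂(Measure.pi fun _ : Fin (n+1) => P) with hm
    have hmg : m = ∫ a, g a ∂P := by
      rw [hm, tr, integral_prod _ hfi]
    have hgl : ∀ a b, |g a - g b| ≤ |L 0| * dist a b := by
      intro a b
      simp only [hg]
      rw [← integral_sub ((h.cons_right a).integrable P hP) ((h.cons_right b).integrable P hP)]
      have := norm_integral_le_of_norm_le_const (μ := ν) (C := |L 0| * dist a b)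
        (f := fun v => f (Fin.cons a v) - f (Fin.cons b v))
        (Filter.Eventually.of_forall fun v => by
          have := h (Fin.cons a v) 0 b
          rw [Fin.update_cons_zero, Fin.cons_zero] at this
          exact this.trans (mul_le_mul_of_nonneg_right (le_abs_self _) dist_nonneg))
      simpa using this
    have hgc : Continuous g := by
      refine (LipschitzWith.of_dist_le_mul (K := ⟨|L 0|, abs_nonneg _⟩) fun a b => ?_).continuous
      exact hgl a b
    have hgb : ∀ᵐ a ∂P, g a ∈ Set.Icc (g 0 - |L 0|) (g 0 + |L 0|) := by
      filter_upwards [hP] with a ha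
      have h1 := hgl a 0
      rw [dist_zero_right] at h1
      have h2 := h1.trans (mul_le_of_le_one_right (abs_nonneg _) ha)
      rw [abs_le] at h2
      constructor <;> linarith [h2.1, h2.2]
    have hsub := ProbabilityTheory.hasSubgaussianMGF_of_mem_Icc (μ := P)
      hgc.measurable.aemeasurable hgb
    have h1 := hsub.mgf_le t
    have hi1 := hsub.integrable_exp_mul t
    rw [ProbabilityTheory.mgf, ← hmg] at h1
    rw [← hmg] at hi1
    have hconst : (((‖(g 0 + |L 0|) - (g 0 - |L 0|)‖₊ / 2) ^ 2 : NNReal) : ℝ) = L 0 ^ 2 := by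
      push_cast
      rw [Real.norm_eq_abs]
      have : g 0 + |L 0| - (g 0 - |L 0|) = 2 * |L 0| := by ring
      rw [this, abs_mul, abs_abs, abs_two, mul_div_cancel_left₀ _ two_ne_zero, sq_abs]
    rw [hconst] at h1
    have hei := tri _ (h.integrable_exp P hP t m)
    rw [tr, integral_prod _ hei, Fin.sum_univ_succ]
    have hstep : ∀ a, ∫ v, Real.exp (t * (f (Fin.cons a v) - m)) ∂ν
        ≤ Real.exp ((∑ j : Fin n, L j.succ ^ 2) * t ^ 2 / 2) * Real.exp (t * (g a - m)) := by
      intro a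
      have := ih (h.cons_right a) t
      have e : ∀ v, Real.exp (t * (f (Fin.cons a v) - m))
          = Real.exp (t * (f (Fin.cons a v) - g a)) * Real.exp (t * (g a - m)) := by
        intro v; rw [← Real.exp_add]; ring_nf
      simp_rw [e]
      rw [integral_mul_const]
      exact mul_le_mul_of_nonneg_right this (Real.exp_pos _).le
    calc _ ≤ ∫ a, Real.exp ((∑ j : Fin n, L j.succ ^ 2) * t ^ 2 / 2)
            * Real.exp (t * (g a - m)) ∂P :=
          integral_mono hei.integral_prod_left (hi1.const_mul _) hstep
      _ = Real.exp ((∑ j : Fin n, L j.succ ^ 2) * t ^ 2 / 2)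
            * ∫ a, Real.exp (t * (g a - m)) ∂P := integral_const_mul _ _
      _ ≤ Real.exp ((∑ j : Fin n, L j.succ ^ 2) * t ^ 2 / 2) * Real.exp (L 0 ^ 2 * t ^ 2 / 2) :=
          mul_le_mul_of_nonneg_left h1 (Real.exp_pos _).le
      _ = _ := by rw [← Real.exp_add]; ring_nf

theorem SepLip.neg {E : Type*} [PseudoMetricSpace E] {n : ℕ} {f : (Fin n → E) → ℝ}
    {L : Fin n → ℝ} (h : SepLip f L) : SepLip (fun v => - f v) L := by
  intro x j y
  have := h x j y
  rwa [← abs_neg, show -(-f x - -f (Function.update x j y)) = f x - f (Function.update x j y) by ring]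

theorem exp_neg_bound (p u : ℝ) (hp : 0 < p) (hu : 0 < u) :
    Real.exp (-u) ≤ p ^ p / u ^ p := by
  rw [le_div_iff₀ (Real.rpow_pos_of_pos hu p), Real.exp_neg, inv_mul_le_iff₀ (Real.exp_pos _)]
  have h1 : u / p ≤ Real.exp (u / p) := by linarith [Real.add_one_le_exp (u / p)]
  have h2 : (u / p) ^ p ≤ Real.exp (u / p) ^ p :=
    Real.rpow_le_rpow (by positivity) h1 hp.le
  rw [← Real.exp_mul, div_mul_cancel₀ _ hp.ne', Real.div_rpow hu.le hp.le,
    div_le_iff₀ (Real.rpow_pos_of_pos hp p)] at h2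
  exact h2

theorem SepLip.tail_one (P : Measure E) [IsProbabilityMeasure P] (hP : ∀ᵐ ξ ∂P, ‖ξ‖ ≤ 1)
    {n : ℕ} {f : (Fin n → E) → ℝ} {L : Fin n → ℝ} (h : SepLip f L)
    (hS : 0 < ∑ j, L j ^ 2) (q : ℝ) (hq : 2 ≤ q) (s : ℝ) (hs : 0 < s) :
    (Measure.pi fun _ : Fin n => P).real
      {v | s ≤ f v - ∫ w, f w ∂(Measure.pi fun _ : Fin n => P)}
      ≤ q ^ (q / 2) * (∑ j, L j ^ 2) ^ (q / 2) / s ^ q := by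
  set S := ∑ j, L j ^ 2 with hSdef
  have hsg : ProbabilityTheory.HasSubgaussianMGF
      (fun v => f v - ∫ w, f w ∂(Measure.pi fun _ : Fin n => P)) ⟨S, hS.le⟩
      (Measure.pi fun _ : Fin n => P) :=
    ⟨fun t => h.integrable_exp P hP t _, fun t => h.mcdiarmid P hP t⟩
  refine (hsg.measure_ge_le hs.le).trans ?_
  have h1 := exp_neg_bound (q / 2) (s ^ 2 / (2 * S)) (by linarith) (by positivity)
  rw [neg_div]
  refine h1.trans (le_of_eq ?_)
  rw [Real.div_rpow (x := s ^ 2) (by positivity) (by positivity),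
    Real.div_rpow (x := q) (by linarith) (by norm_num),
    Real.mul_rpow (by norm_num) hS.le, ← Real.rpow_natCast s 2, ← Real.rpow_mul hs.le]
  have : ((2 : ℕ) : ℝ) * (q / 2) = q := by push_cast; ring
  rw [this]
  have : (2 : ℝ) ^ (q / 2) ≠ 0 := by positivity
  have : s ^ q ≠ 0 := by positivity
  field_simp

theorem SepLip.tail_two (P : Measure E) [IsProbabilityMeasure P] (hP : ∀ᵐ ξ ∂P, ‖ξ‖ ≤ 1)
    {n : ℕ} {f : (Fin n → E) → ℝ} {L : Fin n → ℝ} (h : SepLip f L)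
    (hS : 0 < ∑ j, L j ^ 2) (q : ℝ) (hq : 2 ≤ q) (s : ℝ) (hs : 0 < s) :
    (Measure.pi fun _ : Fin n => P).real
      {v | s ≤ |f v - ∫ w, f w ∂(Measure.pi fun _ : Fin n => P)|}
      ≤ 2 * (q ^ (q / 2) * (∑ j, L j ^ 2) ^ (q / 2) / s ^ q) := by
  have h1 := h.tail_one P hP hS q hq s hs
  have h2 := h.neg.tail_one P hP hS q hq s hs
  rw [integral_neg] at h2
  refine (measureReal_mono (fun v hv => ?_)).trans
    ((measureReal_union_le _ _).trans ((add_le_add h1 h2).trans (two_mul _).ge))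
  rcases le_abs.1 (show s ≤ |_| from hv) with h' | h'
  · exact Or.inl h'
  · refine Or.inr ?_
    show s ≤ _
    linarith

theorem SepLip.noise [NormedSpace ℝ E] {n : ℕ} {K : (Fin n → E) → ℝ} {L : Fin n → ℝ}
    (h : SepLip K L) (ε : ℝ) (hε : 0 < ε) (x : Fin n → E) :
    SepLip (fun v : Fin n → E => K (fun i => x i + ε • v i)) (fun j => ε * L j) := by
  intro v j y
  have h1 := h (fun i => x i + ε • v i) j (x j + ε • y)
  have e : Function.update (fun i => x i + ε • v i) j (x j + ε • y)
      = fun i => x i + ε • Function.update v j y i := by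
    ext i
    by_cases hi : i = j
    · subst hi; simp
    · simp [hi]
  rw [e, dist_add_left, dist_smul₀, Real.norm_eq_abs, abs_of_pos hε] at h1
  calc _ ≤ _ := h1
    _ = _ := by ring

theorem SepLip.shift {n : ℕ} {K : (Fin n → E) → ℝ} {L : Fin n → ℝ}
    (h : SepLip K L) (w : Fin n → E) :
    SepLip (fun x : Fin n → E => K (fun i => x i + w i)) L := by
  intro x j y
  have h1 := h (fun i => x i + w i) j (y + w j)
  have e : Function.update (fun i => x i + w i) j (y + w j)
      = fun i => Function.update x j y i + w i := by
    ext i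
    by_cases hi : i = j
    · subst hi; simp
    · simp [hi]
  rwa [e, dist_add_right] at h1

theorem SepLip.average [NormedSpace ℝ E] {n : ℕ} {K : (Fin n → E) → ℝ} {L : Fin n → ℝ}
    (h : SepLip K L) (P : Measure E) [IsProbabilityMeasure P] (hP : ∀ᵐ ξ ∂P, ‖ξ‖ ≤ 1)
    (ε : ℝ) (hε : 0 < ε) :
    SepLip (fun x : Fin n → E =>
      ∫ v, K (fun i => x i + ε • v i) ∂(Measure.pi fun _ : Fin n => P)) L := by
  intro x j y
  show |(∫ v, K (fun i => x i + ε • v i) ∂(Measure.pi fun _ : Fin n => P))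
    - ∫ v, K (fun i => Function.update x j y i + ε • v i) ∂(Measure.pi fun _ : Fin n => P)| ≤ _
  rw [← integral_sub ((h.noise ε hε x).integrable P hP) ((h.noise ε hε _).integrable P hP)]
  have := norm_integral_le_of_norm_le_const (μ := Measure.pi fun _ : Fin n => P)
    (C := L j * dist (x j) y)
    (f := fun v => K (fun i => x i + ε • v i) - K (fun i => Function.update x j y i + ε • v i))
    (Filter.Eventually.of_forall fun v => h.shift (fun i => ε • v i) x j y)
  simpa using this

end Helpers

/-- If the dynamical system `(X,T,μ)` satisfies the polynomial concentration
inequality with moment `q ≥ 2`, then the observed system satisfies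
`μ_n ⊗ P^n(|K(y₀,…,y_{n-1}) - E[K]| > t) ≤ (D_q/t^q)(1+ε)^q (∑ Lip_j(K)²)^{q/2}`. -/
theorem observed_system_polynomial_deviation {d : ℕ}
    (X : Set (EuclideanSpace ℝ (Fin d))) (hX : IsCompact X)
    (T : EuclideanSpace ℝ (Fin d) → EuclideanSpace ℝ (Fin d))
    (hT : Measurable T) (hTX : Set.MapsTo T X X)
    (μ : Measure (EuclideanSpace ℝ (Fin d))) [IsProbabilityMeasure μ]
    (hμX : μ X = 1) (hinv : μ.map T = μ)
    (q : ℝ) (hq : 2 ≤ q) (Cq : ℝ) (hCq : 0 < Cq)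
    (hconc : ∀ (n : ℕ), 1 ≤ n → ∀ (K : (Fin n → EuclideanSpace ℝ (Fin d)) → ℝ)
      (L : Fin n → ℝ), SepLip K L →
      ∫ x, |K (fun i => T^[(i : ℕ)] x)
          - ∫ z, K (fun i => T^[(i : ℕ)] z) ∂μ| ^ q ∂μ
        ≤ Cq * (∑ j, L j ^ 2) ^ (q / 2))
    (P : Measure (EuclideanSpace ℝ (Fin d))) [IsProbabilityMeasure P]
    (hP : ∀ᵐ ξ ∂P, ‖ξ‖ ≤ 1) :
    ∃ Dq : ℝ, 0 < Dq ∧ ∀ ε : ℝ, 0 < ε → ∀ (n : ℕ), 1 ≤ n →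
      ∀ (K : (Fin n → EuclideanSpace ℝ (Fin d)) → ℝ) (L : Fin n → ℝ), SepLip K L →
      ∀ t : ℝ, 0 < t →
      ((μ.prod (Measure.pi fun _ : Fin n => P))
          {p | t < |K (fun i => T^[(i : ℕ)] p.1 + ε • p.2 i)
            - ∫ p', K (fun i => T^[(i : ℕ)] p'.1 + ε • p'.2 i)
                ∂(μ.prod (Measure.pi fun _ : Fin n => P))|}).toReal
        ≤ (Dq / t ^ q) * (1 + ε) ^ q * (∑ j, L j ^ 2) ^ (q / 2) := by
  have hq0 : 0 < q := by linarith
  refine ⟨2 ^ q * (2 * q ^ (q / 2) + Cq), by positivity, ?_⟩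
  intro ε hε n hn K L hK t ht
  set ν := Measure.pi fun _ : Fin n => P with hν
  set F : EuclideanSpace ℝ (Fin d) × (Fin n → EuclideanSpace ℝ (Fin d)) → ℝ :=
    fun p => K (fun i => T^[(i : ℕ)] p.1 + ε • p.2 i) with hF
  change (μ.prod ν).real {p | t < |F p - ∫ p', F p' ∂(μ.prod ν)|} ≤ _
  have hSnn : 0 ≤ ∑ j, L j ^ 2 := Finset.sum_nonneg fun _ _ => sq_nonneg _
  rcases hSnn.eq_or_lt with hS | hS
  · -- degenerate case: the function is constant
    have hL : ∀ j, L j = 0 := by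
      intro j
      have := (Finset.sum_eq_zero_iff_of_nonneg (fun j _ => sq_nonneg (L j))).1 hS.symm j
        (Finset.mem_univ j)
      exact pow_eq_zero_iff two_ne_zero |>.1 this
    have hc : ∀ p, F p = K 0 := by
      intro p
      have := hK.abs_sub_le (fun i => T^[(i : ℕ)] p.1 + ε • p.2 i) 0
      simp only [hL, abs_zero, zero_mul, Finset.sum_const_zero] at this
      exact sub_eq_zero.1 (abs_nonpos_iff.1 this)
    have : {p | t < |F p - ∫ p', F p' ∂(μ.prod ν)|} = ∅ := by
      ext p
      simp [hc, ht.le]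
    rw [this, measureReal_empty]
    positivity
  set S := ∑ j, L j ^ 2 with hSdef
  set G : (Fin n → EuclideanSpace ℝ (Fin d)) → ℝ :=
    fun x => ∫ v, K (fun i => x i + ε • v i) ∂ν with hG
  have hGL : SepLip G L := hK.average P hP ε hε
  set orb : EuclideanSpace ℝ (Fin d) → (Fin n → EuclideanSpace ℝ (Fin d)) :=
    fun x i => T^[(i : ℕ)] x with horb
  have horbm : Measurable orb := measurable_pi_lambda _ fun i => hT.iterate _
  have hKm : Measurable K := hK.continuous.measurable
  have hGm : Measurable (fun x => G (orb x)) := hGL.continuous.measurable.comp horbm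
  have hFm : Measurable F := by
    refine hKm.comp (measurable_pi_lambda _ fun i => ?_)
    have h1 : Measurable (T^[(i : ℕ)]) := hT.iterate _
    fun_prop
  have hae : ∀ᵐ x ∂μ, x ∈ X := (mem_ae_iff_prob_eq_one hX.measurableSet).2 hμX
  obtain ⟨R, hR⟩ := hX.isBounded.exists_norm_le
  have horbb : ∀ x ∈ X, ∀ i, ‖orb x i‖ ≤ R := fun x hx i => hR _ (hTX.iterate _ hx)
  have hFb : ∀ᵐ p ∂(μ.prod ν), |F p| ≤ |K 0| + ∑ j, |L j| * (R + ε) := by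
    filter_upwards [Measure.quasiMeasurePreserving_fst.ae hae,
      Measure.quasiMeasurePreserving_snd.ae (ae_pi_ball P hP n)] with p hp1 hp2
    have h1 := hK.abs_sub_le (fun i => T^[(i : ℕ)] p.1 + ε • p.2 i) 0
    have h2 : ∑ j, |L j| * dist (T^[(j : ℕ)] p.1 + ε • p.2 j)
        ((0 : Fin n → EuclideanSpace ℝ (Fin d)) j) ≤ ∑ j, |L j| * (R + ε) := by
      refine Finset.sum_le_sum fun j _ => mul_le_mul_of_nonneg_left ?_ (abs_nonneg _)
      rw [Pi.zero_apply, dist_zero_right]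
      refine (norm_add_le _ _).trans (add_le_add (horbb _ hp1 j) ?_)
      rw [norm_smul, Real.norm_eq_abs, abs_of_pos hε]
      exact mul_le_of_le_one_right hε.le (hp2 j)
    have h3 := abs_sub_abs_le_abs_sub (F p) (K 0)
    have h4 : |F p - K 0| ≤ _ := h1.trans h2
    linarith
  have hFi : Integrable F (μ.prod ν) :=
    Integrable.of_bound hFm.aestronglyMeasurable _ hFb
  have hmean : ∫ p', F p' ∂(μ.prod ν) = ∫ x, G (orb x) ∂μ := integral_prod _ hFi
  rw [hmean]
  set m := ∫ x, G (orb x) ∂μ with hm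
  have hGb : ∀ᵐ x ∂μ, |G (orb x)| ≤ |G 0| + ∑ j, |L j| * R := by
    filter_upwards [hae] with x hx
    have h1 := hGL.abs_sub_le (orb x) 0
    have h2 : ∑ j, |L j| * dist (orb x j)
        ((0 : Fin n → EuclideanSpace ℝ (Fin d)) j) ≤ ∑ j, |L j| * R := by
      refine Finset.sum_le_sum fun j _ => mul_le_mul_of_nonneg_left ?_ (abs_nonneg _)
      rw [Pi.zero_apply, dist_zero_right]
      exact horbb _ hx j
    have h3 := abs_sub_abs_le_abs_sub (G (orb x)) (G 0)
    linarith
  -- Markov for the dynamical part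
  have hs : 0 < t / 2 := by linarith
  have hA : μ.real {x | t / 2 ≤ |G (orb x) - m|} ≤ Cq * S ^ (q / 2) / (t / 2) ^ q := by
    have hi : Integrable (fun x => |G (orb x) - m| ^ q) μ := by
      have hmeas : Measurable (fun x => |G (orb x) - m| ^ q) := 
        (hGm.sub_const m).abs.pow_const q
      refine Integrable.of_bound hmeas.aestronglyMeasurable
        ((|G 0| + ∑ j, |L j| * R + |m|) ^ q) ?_
      filter_upwards [hGb] with x hx
      rw [Real.norm_eq_abs, abs_of_nonneg (by positivity)]
      refine Real.rpow_le_rpow (abs_nonneg _) ?_ hq0.le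
      have := abs_sub (G (orb x)) m
      linarith
    have h1 := mul_meas_ge_le_integral_of_nonneg
      (Filter.Eventually.of_forall fun x => by positivity) hi ((t / 2) ^ q)
    have h2 := hconc n hn G L hGL
    have e : {x | t / 2 ≤ |G (orb x) - m|} = {x | (t / 2) ^ q ≤ |G (orb x) - m| ^ q} := by
      ext x
      exact (Real.rpow_le_rpow_iff hs.le (abs_nonneg _) hq0).symm
    rw [e, le_div_iff₀ (by positivity), mul_comm]
    exact h1.trans h2
  -- the noise part
  set B := 2 * (q ^ (q / 2) * (ε ^ q * S ^ (q / 2)) / (t / 2) ^ q) with hB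
  have hB0 : 0 ≤ B := by positivity
  have hN : ∀ x, ν.real {v | t / 2 ≤ |F (x, v) - G (orb x)|} ≤ B := by
    intro x
    have hsum : ∑ j, (ε * L j) ^ 2 = ε ^ 2 * S := by
      simp only [mul_pow, hSdef, Finset.mul_sum]
    have h1 := (hK.noise ε hε (orb x)).tail_two P hP (by rw [hsum]; positivity) q hq (t / 2) hs
    rw [hsum, Real.mul_rpow (by positivity) hS.le, ← Real.rpow_natCast ε 2,
      ← Real.rpow_mul hε.le, show ((2 : ℕ) : ℝ) * (q / 2) = q by push_cast; ring] at h1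
    exact h1
  have hC : (μ.prod ν).real {p | t / 2 ≤ |F p - G (orb p.1)|} ≤ B := by
    have hms : MeasurableSet {p : EuclideanSpace ℝ (Fin d) × (Fin n → EuclideanSpace ℝ (Fin d)) |
        t / 2 ≤ |F p - G (orb p.1)|} := by
      refine measurableSet_le measurable_const ?_
      exact (hFm.sub (hGm.comp measurable_fst)).abs
    refine ENNReal.toReal_le_of_le_ofReal hB0 ?_
    rw [Measure.prod_apply hms]
    calc _ ≤ ∫⁻ _, ENNReal.ofReal B ∂μ := by
          refine lintegral_mono fun x => ?_
          exact (ENNReal.le_ofReal_iff_toReal_le (measure_ne_top _ _) hB0).2 (hN x)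
      _ = ENNReal.ofReal B := by simp
  have hA' : (μ.prod ν).real {p | t / 2 ≤ |G (orb p.1) - m|} ≤ Cq * S ^ (q / 2) / (t / 2) ^ q := by
    refine le_trans (le_of_eq ?_) hA
    have hms : MeasurableSet {x | t / 2 ≤ |G (orb x) - m|} :=
      measurableSet_le measurable_const (hGm.sub_const m).abs
    exact (measurePreserving_fst (μ := μ) (ν := ν)).measureReal_preimage hms.nullMeasurableSet
  have hfin : (μ.prod ν).real {p | t < |F p - m|} ≤ B + Cq * S ^ (q / 2) / (t / 2) ^ q := by
    refine (measureReal_mono (fun p hp => ?_)).trans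
      ((measureReal_union_le _ _).trans (add_le_add hC hA'))
    by_contra hcon
    simp only [Set.mem_union, Set.mem_ofPred_eq, not_or, not_le] at hcon hp
    have := abs_sub_le (F p) (G (orb p.1)) m
    linarith [hcon.1, hcon.2]
  refine hfin.trans ?_
  have e1 : ε ^ q ≤ (1 + ε) ^ q := Real.rpow_le_rpow hε.le (by linarith) hq0.le
  have e2 : 1 ≤ (1 + ε) ^ q := Real.one_le_rpow (by linarith) hq0.le
  have eq1 : B + Cq * S ^ (q / 2) / (t / 2) ^ q
      = (2 ^ q / t ^ q * S ^ (q / 2)) * (2 * q ^ (q / 2) * ε ^ q + Cq * 1) := by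
    rw [hB, Real.div_rpow ht.le two_pos.le]
    have : (2 : ℝ) ^ q ≠ 0 := by positivity
    have : t ^ q ≠ 0 := by positivity
    field_simp
  have eq2 : 2 ^ q * (2 * q ^ (q / 2) + Cq) / t ^ q * (1 + ε) ^ q * S ^ (q / 2)
      = (2 ^ q / t ^ q * S ^ (q / 2))
        * (2 * q ^ (q / 2) * (1 + ε) ^ q + Cq * (1 + ε) ^ q) := by ring
  rw [eq1, eq2]
  gcongr
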